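/- Let W be an m-dimensional subspace of ℝ^d and {u_1,...,u_{m+1}} ⊂ W unit vectors with Σu_j = 0 and ⟨u_j,u_k⟩ = -1/m for j≠k. Then for every nonzero w ∈ W there exists k such that ⟨w, u_k⟩ ≥ ‖w‖/m, i.e., the angle between w and u_k is at most arccos(1/m). -/

import Mathlib

open scoped RealInnerProductSpace

section RegularSimplex

variable {E : Type*} [NormedAddCommGroup E] [InnerProductSpace ℝ E] {m : ℕ}
  {u : Fin (m + 1) → E}

/-- The Gram matrix of a regular simplex is a scalar matrix minus a constant one. -/
lemma simplex_inner_eq_ite (hu_norm : ∀ j, ‖u j‖ = 1)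
    (hu_inner : ∀ j k, j ≠ k → ⟪u j, u k⟫ = -(1 / (m : ℝ))) (j k : Fin (m + 1)) :
    ⟪u j, u k⟫ = (if j = k then 1 + 1 / (m : ℝ) else 0) - 1 / (m : ℝ) := by
  split_ifs with h
  · subst h
    rw [real_inner_self_eq_norm_sq, hu_norm]
    ring
  · rw [hu_inner j k h]
    ring

/-- All but one of the vertices of a regular simplex are linearly independent. -/
lemma simplex_linearIndependent_castSucc (hu_norm : ∀ j, ‖u j‖ = 1)
    (hu_inner : ∀ j k, j ≠ k → ⟪u j, u k⟫ = -(1 / (m : ℝ))) :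
    LinearIndependent ℝ (fun i : Fin m => u i.castSucc) := by
  rw [Fintype.linearIndependent_iff]
  intro g hg i
  have key : ∀ k, ∑ j : Fin m, g j * ⟪u j.castSucc, u k⟫ = 0 := fun k => by
    simpa [sum_inner, real_inner_smul_left] using congrArg (fun x => ⟪x, u k⟫) hg
  have hlast := key (Fin.last m)
  have hi := key i.castSucc
  simp only [simplex_inner_eq_ite hu_norm hu_inner, mul_sub, Finset.sum_sub_distrib,
    Fin.castSucc_ne_last, Fin.castSucc_inj, if_false, mul_ite, mul_zero, Finset.sum_const_zero,
    Finset.sum_ite_eq', Finset.mem_univ, if_true] at hlast hi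
  have hprod : g i * (1 + 1 / (m : ℝ)) = 0 := by linarith
  exact (mul_eq_zero.mp hprod).resolve_right (by positivity)

/-- The vertices of a regular simplex form a tight frame of their span. -/
lemma simplex_sum_inner_smul (hu_norm : ∀ j, ‖u j‖ = 1) (hu_sum : ∑ j, u j = 0)
    (hu_inner : ∀ j k, j ≠ k → ⟪u j, u k⟫ = -(1 / (m : ℝ)))
    {w : E} (hw : w ∈ Submodule.span ℝ (Set.range u)) :
    ∑ j, ⟪w, u j⟫ • u j = (1 + 1 / (m : ℝ)) • w := by
  induction hw using Submodule.span_induction with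
  | mem x hx =>
    obtain ⟨k, rfl⟩ := hx
    simp [simplex_inner_eq_ite hu_norm hu_inner, sub_smul, Finset.sum_sub_distrib,
      ← Finset.smul_sum, hu_sum, ite_smul]
  | zero => simp
  | add x y _ _ hx hy => simp [inner_add_left, add_smul, Finset.sum_add_distrib, hx, hy]
  | smul a x _ hx =>
    simp only [real_inner_smul_left, mul_smul, ← Finset.smul_sum, hx]
    exact smul_comm _ _ _

/-- Some vertex of a regular simplex makes a large inner product with a given nonzero vector of
its span. -/
lemma simplex_exists_norm_div_le_inner (hm : 1 ≤ m) (hu_norm : ∀ j, ‖u j‖ = 1)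
    (hu_sum : ∑ j, u j = 0) (hu_inner : ∀ j k, j ≠ k → ⟪u j, u k⟫ = -(1 / (m : ℝ)))
    {w : E} (hw_mem : w ∈ Submodule.span ℝ (Set.range u)) (hw : w ≠ 0) :
    ∃ k, ‖w‖ / (m : ℝ) ≤ ⟪w, u k⟫ := by
  by_contra! hlt
  have hm0 : (0 : ℝ) < m := by exact_mod_cast hm
  have hw0 : 0 < ‖w‖ := norm_pos_iff.mpr hw
  have hsum : ∑ j, ⟪w, u j⟫ = 0 := by rw [← inner_sum, hu_sum, inner_zero_right]
  have hsq : ∑ j, ⟪w, u j⟫ ^ 2 = (1 + 1 / (m : ℝ)) * ‖w‖ ^ 2 := by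
    have h := congrArg (fun x => ⟪w, x⟫) (simplex_sum_inner_smul hu_norm hu_sum hu_inner hw_mem)
    simpa only [inner_sum, real_inner_smul_right, real_inner_self_eq_norm_sq, ← pow_two] using h
  have hge : ∀ j, 0 ≤ ⟪w, u j⟫ + ‖w‖ := fun j => by
    have h := neg_le_of_abs_le (abs_real_inner_le_norm w (u j))
    rw [hu_norm, mul_one] at h
    linarith
  have hzero : ∑ j, (‖w‖ / m - ⟪w, u j⟫) * (⟪w, u j⟫ + ‖w‖) = 0 := by
    have hexpand : ∀ j, (‖w‖ / m - ⟪w, u j⟫) * (⟪w, u j⟫ + ‖w‖) =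
        ‖w‖ ^ 2 / m + (‖w‖ / m - ‖w‖) * ⟪w, u j⟫ - ⟪w, u j⟫ ^ 2 := fun j => by ring
    simp only [hexpand, Finset.sum_sub_distrib, Finset.sum_add_distrib, ← Finset.mul_sum, hsum,
      hsq, Finset.sum_const, Finset.card_univ, Fintype.card_fin, nsmul_eq_mul]
    push_cast
    field_simp
    ring
  rw [Finset.sum_eq_zero_iff_of_nonneg
    fun j _ => mul_nonneg (sub_pos.mpr (hlt j)).le (hge j)] at hzero
  have hneg : ∀ j, ⟪w, u j⟫ < 0 := fun j => by
    have h := (mul_eq_zero.mp (hzero j (Finset.mem_univ j))).resolve_left (sub_pos.mpr (hlt j)).ne'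
    linarith
  exact (Finset.sum_neg (fun j _ => hneg j) Finset.univ_nonempty).ne hsum

end RegularSimplex

/-- The regular simplex alphabet is an angular net: for every nonzero `w ∈ W` there is a
simplex vertex `u_k` with `⟨w, u_k⟩ ≥ ‖w‖/m`, i.e. `angle(w, u_k) ≤ arccos(1/m)`. -/
theorem stmt_1 (d m : ℕ) (hm : 1 ≤ m)
    (W : Submodule ℝ (EuclideanSpace ℝ (Fin d)))
    (hW : Module.finrank ℝ W = m)
    (u : Fin (m + 1) → EuclideanSpace ℝ (Fin d))
    (hu_mem : ∀ j, u j ∈ W)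
    (hu_norm : ∀ j, ‖u j‖ = 1)
    (hu_sum : ∑ j, u j = 0)
    (hu_inner : ∀ j k, j ≠ k → ⟪u j, u k⟫ = -(1 / (m : ℝ)))
    (w : EuclideanSpace ℝ (Fin d)) (hw_mem : w ∈ W) (hw : w ≠ 0) :
    ∃ k, ‖w‖ / (m : ℝ) ≤ ⟪w, u k⟫ ∧
      InnerProductGeometry.angle w (u k) ≤ Real.arccos (1 / (m : ℝ)) := by
  have hspan : Submodule.span ℝ (Set.range fun i : Fin m => u i.castSucc) = W := by
    refine Submodule.eq_of_le_of_finrank_eq ?_ ?_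
    · rw [Submodule.span_le]
      rintro _ ⟨i, rfl⟩
      exact hu_mem _
    · rw [finrank_span_eq_card (simplex_linearIndependent_castSucc hu_norm hu_inner), hW,
        Fintype.card_fin]
  have hw_span : w ∈ Submodule.span ℝ (Set.range u) := by
    rw [← hspan] at hw_mem
    exact Submodule.span_mono (Set.range_comp_subset_range Fin.castSucc u) hw_mem
  obtain ⟨k, hk⟩ := simplex_exists_norm_div_le_inner hm hu_norm hu_sum hu_inner hw_span hw
  refine ⟨k, hk, Real.arccos_le_arccos ?_⟩
  rw [hu_norm, mul_one, le_div_iff₀ (norm_pos_iff.mpr hw), one_div_mul_eq_div]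
  exact hk
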